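/- arXiv:2512.08119 — 2 statements merged into one kernel-verified Lean document; each statement's English description precedes it below -/
import Mathlib

section
/- Let q ∈ (0,1), let a₁,a₂,a₃ be nonzero complex numbers, and let n ∈ ℤ≥0. Set b₁ = a₁+a₂+a₃, b₂ = a₁a₂+a₁a₃+a₂a₃, b₃ = a₁a₂a₃. Then for all x ∈ ℂ: ∏_{j=1}^{3}(1−a_j e^{ix})(1−a_j e^{−ix}) · p_n(cos x; qa₁, qa₂, qa₃ | q) = −b₃ · p_{n+3}(cos x; a₁,a₂,a₃|q) + [ b₂ − (1+q) b₁ b₃ q^{n+1} + (1+q+q²) b₃² q^{2n+2} ] · p_{n+2}(cos x; a₁,a₂,a₃|q) − [ b₁ − (1+q+q²) b₃ q^{n} ] · ∏_{1≤j<k≤3}(1 − a_j a_k q^{n+1}) · p_{n+1}(cos x; a₁,a₂,a₃|q) + ∏_{1≤j<k≤3}(1 − a_j a_k q^{n})(1 − a_j a_k q^{n+1}) · p_n(cos x; a₁,a₂,a₃|q). -/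
open Complex Finset

/-- q-Pochhammer symbol `(a;q)_k = ∏_{j=0}^{k-1} (1 - a q^j)`. -/
noncomputable def qPoch (q a : ℂ) (k : ℕ) : ℂ := ∏ j ∈ Finset.range k, (1 - a * q ^ j)

/-- Continuous dual q-Hahn polynomial `p_n(cos x; a₁,a₂,a₃ | q)` as a function of `x ∈ ℂ`. -/
noncomputable def cdqHPoly (q a₁ a₂ a₃ : ℂ) (n : ℕ) (x : ℂ) : ℂ :=
  a₁ ^ (-(n : ℤ)) * ∑ k ∈ Finset.range (n + 1),
    qPoch q (q ^ (-(n : ℤ))) k * qPoch q (a₁ * Complex.exp (Complex.I * x)) k *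
      qPoch q (a₁ * Complex.exp (-(Complex.I * x))) k * q ^ k / qPoch q q k *
      (qPoch q (a₁ * a₂ * q ^ k) (n - k) * qPoch q (a₁ * a₃ * q ^ k) (n - k))

lemma qPoch_succ_right (q a : ℂ) (k : ℕ) :
    qPoch q a (k+1) = qPoch q a k * (1 - a * q ^ k) := by
  simp [qPoch, Finset.prod_range_succ]

lemma qPoch_succ_left (q a : ℂ) (k : ℕ) :
    qPoch q a (k+1) = (1 - a) * qPoch q (a * q) k := by
  simp only [qPoch, Finset.prod_range_succ']
  rw [mul_comm]
  congr 1
  · simp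
  · apply Finset.prod_congr rfl
    intro j _
    ring

/-- coefficient in the expansion of the polynomial -/
noncomputable def cf (q a b c : ℂ) (n k : ℕ) : ℂ :=
  (a ^ n)⁻¹ * (qPoch q ((q ^ n)⁻¹) k * q ^ k / qPoch q q k *
    (qPoch q (a * b * q ^ k) (n - k) * qPoch q (a * c * q ^ k) (n - k)))

/-- basis functions -/
noncomputable def ph (q a u v : ℂ) (k : ℕ) : ℂ := qPoch q (a * u) k * qPoch q (a * v) k

lemma cdq_eq (q a b c : ℂ) (n : ℕ) (x : ℂ) :
    cdqHPoly q a b c n x = ∑ k ∈ Finset.range (n+1),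
      cf q a b c n k * ph q a (Complex.exp (Complex.I * x)) (Complex.exp (-(Complex.I * x))) k := by
  unfold cdqHPoly cf ph
  rw [Finset.mul_sum]
  apply Finset.sum_congr rfl
  intro k _
  simp only [zpow_neg, zpow_natCast]
  ring

lemma qPoch_top (q : ℂ) (hq : q ≠ 0) (n : ℕ) : qPoch q ((q ^ n)⁻¹) (n+1) = 0 := by
  rw [qPoch_succ_right]
  have : q ^ n ≠ 0 := pow_ne_zero _ hq
  field_simp
  simp

lemma cf_top (q a b c : ℂ) (hq : q ≠ 0) (n : ℕ) : cf q a b c n (n+1) = 0 := by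
  simp [cf, qPoch_top q hq n]

lemma qq_ne (q : ℂ) (hq : ∀ k : ℕ, q ^ (k+1) ≠ 1) (k : ℕ) : qPoch q q k ≠ 0 := by
  unfold qPoch
  rw [Finset.prod_ne_zero_iff]
  intro j _ h
  apply hq j
  rw [pow_succ]
  linear_combination -h

lemma cf_zero (q a b c : ℂ) (n : ℕ) :
    cf q a b c n 0 = (a ^ n)⁻¹ * (qPoch q (a * b) n * qPoch q (a * c) n) := by
  simp [cf, qPoch]

lemma qinv_shift (q : ℂ) (hq : q ≠ 0) (n : ℕ) : (q ^ (n+1))⁻¹ * q = (q ^ n)⁻¹ := by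
  have : q ^ n ≠ 0 := pow_ne_zero _ hq
  rw [pow_succ]
  field_simp

/-- first parameter: coefficients -/
lemma cf_one (q a b c : ℂ) (hq : q ≠ 0) (hq' : ∀ k : ℕ, q ^ (k+1) ≠ 1) (ha : a ≠ 0)
    (n k : ℕ) (hk : k ≤ n) :
    cf q (q * a) b c n k = (1 - a * b * q ^ n) * (1 - a * c * q ^ n) * cf q a b c n (k+1)
      - a * cf q a b c (n+1) (k+1) := by
  have h1 := qq_ne q hq' k
  have h3 : (1 - q * q ^ k) ≠ 0 := by
    intro h; apply hq' k; rw [pow_succ]; linear_combination -h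
  have hqk : q ^ k ≠ 0 := pow_ne_zero _ hq
  have han : a ^ n ≠ 0 := pow_ne_zero _ ha
  rcases hk.lt_or_eq with h | rfl
  · obtain ⟨m, rfl⟩ : ∃ m, n = k + 1 + m := ⟨n - k - 1, by omega⟩
    unfold cf
    have e1 : k + 1 + m - k = m + 1 := by omega
    have e2 : k + 1 + m - (k + 1) = m := by omega
    have e3 : k + 1 + m + 1 - (k + 1) = m + 1 := by omega
    have e4 : ∀ d : ℂ, q * a * d * q ^ k = a * d * q ^ (k+1) := by intro d; ring
    rw [e1, e2, e3, e4, e4]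
    rw [qPoch_succ_right q (a * b * q ^ (k+1)), qPoch_succ_right q (a * c * q ^ (k+1)),
      qPoch_succ_left q ((q ^ (k+1+m+1))⁻¹), qinv_shift q hq, qPoch_succ_right q _ k,
      qPoch_succ_right q q k]
    generalize qPoch q (a * b * q ^ (k+1)) m = B
    generalize qPoch q (a * c * q ^ (k+1)) m = C
    generalize qPoch q ((q ^ (k+1+m))⁻¹) k = D
    generalize qPoch q q k = Q at *
    have hqm : q ^ m ≠ 0 := pow_ne_zero _ hq
    have ham : a ^ m ≠ 0 := pow_ne_zero _ ha
    have hak : a ^ k ≠ 0 := pow_ne_zero _ ha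
    simp only [pow_add, mul_pow, pow_one]
    have h3' : 1 - q ^ k * q ≠ 0 := by rwa [mul_comm]
    generalize q ^ k = K at *
    generalize q ^ m = M at *
    generalize a ^ k = aK at *
    generalize a ^ m = aM at *
    field_simp
    ring
  · rw [cf_top _ _ _ _ hq]
    unfold cf
    simp only [Nat.sub_self]
    rw [qPoch_succ_left q ((q ^ (k+1))⁻¹), qinv_shift q hq, qPoch_succ_right q q k]
    generalize qPoch q ((q ^ k)⁻¹) k = D
    generalize qPoch q q k = Q at *
    simp only [qPoch, Finset.prod_range_zero]
    simp only [pow_add, mul_pow, pow_one]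
    have h3' : 1 - q ^ k * q ≠ 0 := by rwa [mul_comm]
    generalize q ^ k = K at *
    generalize a ^ k = aK at *
    field_simp
    ring

lemma cf_one_zero (q a b c : ℂ) (ha : a ≠ 0) (n : ℕ) :
    0 = (1 - a * b * q ^ n) * (1 - a * c * q ^ n) * cf q a b c n 0
      - a * cf q a b c (n+1) 0 := by
  have han : a ^ n ≠ 0 := pow_ne_zero _ ha
  rw [cf_zero, cf_zero, qPoch_succ_right, qPoch_succ_right, pow_succ]
  field_simp
  ring

/-- third parameter: coefficients -/
lemma cf_three (q a b c : ℂ) (hq : q ≠ 0) (hq' : ∀ k : ℕ, q ^ (k+1) ≠ 1) (ha : a ≠ 0)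
    (n k : ℕ) (hk : k ≤ n) :
    cf q a b (q * c) n (k+1) * ((1 - c / (a * q ^ (k+1))) * (1 - a * c * q ^ (k+1)))
      + cf q a b (q * c) n k * (c / (a * q ^ k))
    = (1 - a * c * q ^ n) * (1 - b * c * q ^ n) * cf q a b c n (k+1)
      - c * cf q a b c (n+1) (k+1) := by
  have h1 := qq_ne q hq' k
  have h3 : (1 - q * q ^ k) ≠ 0 := by
    intro h; apply hq' k; rw [pow_succ]; linear_combination -h
  have hqk : q ^ k ≠ 0 := pow_ne_zero _ hq
  have han : a ^ n ≠ 0 := pow_ne_zero _ ha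
  rcases hk.lt_or_eq with h | rfl
  · obtain ⟨m, rfl⟩ : ∃ m, n = k + 1 + m := ⟨n - k - 1, by omega⟩
    unfold cf
    have e1 : k + 1 + m - k = m + 1 := by omega
    have e2 : k + 1 + m - (k + 1) = m := by omega
    have e3 : k + 1 + m + 1 - (k + 1) = m + 1 := by omega
    have e4 : a * (q * c) * q ^ k = a * c * q ^ (k+1) := by ring
    have e5 : a * (q * c) * q ^ (k+1) = a * c * q ^ (k+1) * q := by ring
    have e6 : a * b * q ^ k * q = a * b * q ^ (k+1) := by ring
    have key := (qPoch_succ_left q (a * c * q ^ (k+1)) m).symm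
    rw [qPoch_succ_right] at key
    rw [e1, e2, e3, e4, e5]
    rw [qPoch_succ_left q (a * b * q ^ k), e6, qPoch_succ_right q (a * b * q ^ (k+1)),
      qPoch_succ_right q (a * c * q ^ (k+1)),
      qPoch_succ_left q ((q ^ (k+1+m+1))⁻¹), qinv_shift q hq, qPoch_succ_right q _ k,
      qPoch_succ_right q q k]
    generalize qPoch q (a * b * q ^ (k+1)) m = B
    generalize qPoch q (a * c * q ^ (k+1) * q) m = C' at *
    generalize qPoch q (a * c * q ^ (k+1)) m = C at *
    generalize qPoch q ((q ^ (k+1+m))⁻¹) k = D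
    generalize qPoch q q k = Q at *
    have hqm : q ^ m ≠ 0 := pow_ne_zero _ hq
    have ham : a ^ m ≠ 0 := pow_ne_zero _ ha
    have hak : a ^ k ≠ 0 := pow_ne_zero _ ha
    have step : ∀ X Y Z : ℂ, X * (Y * C') * (Z * (1 - a * c * q ^ (k+1)))
        = X * Y * Z * (C * (1 - a * c * q ^ (k + 1) * q ^ m)) := by
      intro X Y Z; rw [← key]; ring
    rw [← mul_assoc ((a ^ (k+1+m))⁻¹), step]
    clear key step
    simp only [pow_add, mul_pow, pow_one]
    have h3' : 1 - q ^ k * q ≠ 0 := by rwa [mul_comm]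
    generalize q ^ k = K at *
    generalize q ^ m = M at *
    generalize a ^ k = aK at *
    generalize a ^ m = aM at *
    field_simp
    ring
  · rw [cf_top _ _ _ _ hq, cf_top _ _ _ _ hq]
    unfold cf
    simp only [Nat.sub_self]
    rw [qPoch_succ_left q ((q ^ (k+1))⁻¹), qinv_shift q hq, qPoch_succ_right q q k]
    generalize qPoch q ((q ^ k)⁻¹) k = D
    generalize qPoch q q k = Q at *
    simp only [qPoch, Finset.prod_range_zero]
    simp only [pow_add, mul_pow, pow_one]
    have h3' : 1 - q ^ k * q ≠ 0 := by rwa [mul_comm]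
    generalize q ^ k = K at *
    generalize a ^ k = aK at *
    field_simp
    ring

lemma cf_three_zero (q a b c : ℂ) (ha : a ≠ 0) (n : ℕ) :
    cf q a b (q * c) n 0 * ((1 - c / a) * (1 - a * c))
    = (1 - a * c * q ^ n) * (1 - b * c * q ^ n) * cf q a b c n 0
      - c * cf q a b c (n+1) 0 := by
  have han : a ^ n ≠ 0 := pow_ne_zero _ ha
  have key := (qPoch_succ_left q (a * c) n).symm
  rw [qPoch_succ_right] at key
  have e5 : a * (q * c) = a * c * q := by ring
  rw [cf_zero, cf_zero, cf_zero, qPoch_succ_right, qPoch_succ_right, pow_succ, e5]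
  have step : ∀ X Y Z : ℂ, X * (Y * qPoch q (a * c * q) n) * (Z * (1 - a * c))
        = X * Y * Z * (qPoch q (a * c) n * (1 - a * c * q ^ n)) := by
      intro X Y Z; rw [← key]; ring
  rw [step]
  field_simp
  ring

lemma ph_shift (q a u v : ℂ) (k : ℕ) :
    (1 - a * u) * (1 - a * v) * ph q (q * a) u v k = ph q a u v (k+1) := by
  unfold ph
  rw [qPoch_succ_left, qPoch_succ_left, show q * a * u = a * u * q by ring,
    show q * a * v = a * v * q by ring]
  ring

lemma ph_mul (q a c u v : ℂ) (hq : q ≠ 0) (ha : a ≠ 0) (huv : u * v = 1) (k : ℕ) :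
    (1 - c * u) * (1 - c * v) * ph q a u v k =
      (1 - c / (a * q ^ k)) * (1 - a * c * q ^ k) * ph q a u v k
        + c / (a * q ^ k) * ph q a u v (k+1) := by
  unfold ph
  rw [qPoch_succ_right, qPoch_succ_right]
  have hqk : q ^ k ≠ 0 := pow_ne_zero _ hq
  have : (1 - c * u) * (1 - c * v) = (1 - c / (a * q ^ k)) * (1 - a * c * q ^ k)
      + c / (a * q ^ k) * ((1 - a * u * q ^ k) * (1 - a * v * q ^ k)) := by
    generalize q ^ k = K at *
    field_simp
    linear_combination (c ^ 2 * a * K - c * a ^ 2 * K ^ 2) * huv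
  rw [this]
  ring

lemma sum_ext (q a b c u v : ℂ) (hq : q ≠ 0) (n : ℕ) :
    ∑ k ∈ Finset.range (n+1), cf q a b c n k * ph q a u v k
      = ∑ k ∈ Finset.range (n+1), cf q a b c n (k+1) * ph q a u v (k+1)
        + cf q a b c n 0 * ph q a u v 0 := by
  rw [← Finset.sum_range_succ' (fun k => cf q a b c n k * ph q a u v k),
    Finset.sum_range_succ _ (n+1), cf_top _ _ _ _ hq]
  ring

lemma step_one (q a b c x : ℂ) (hq : q ≠ 0) (hq' : ∀ k : ℕ, q ^ (k+1) ≠ 1) (ha : a ≠ 0)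
    (n : ℕ) :
    (1 - a * Complex.exp (Complex.I * x)) * (1 - a * Complex.exp (-(Complex.I * x))) *
      cdqHPoly q (q * a) b c n x
    = (1 - a * b * q ^ n) * (1 - a * c * q ^ n) * cdqHPoly q a b c n x
      - a * cdqHPoly q a b c (n+1) x := by
  simp only [cdq_eq]
  generalize Complex.exp (Complex.I * x) = u
  generalize Complex.exp (-(Complex.I * x)) = v
  rw [sum_ext q a b c u v hq, Finset.sum_range_succ' _ (n+1)]
  have h0 := cf_one_zero q a b c ha n
  have : (1 - a * u) * (1 - a * v) * ∑ k ∈ Finset.range (n+1),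
      cf q (q * a) b c n k * ph q (q * a) u v k
      = (1 - a * b * q ^ n) * (1 - a * c * q ^ n) *
          ∑ k ∈ Finset.range (n+1), cf q a b c n (k+1) * ph q a u v (k+1)
        - a * ∑ k ∈ Finset.range (n+1), cf q a b c (n+1) (k+1) * ph q a u v (k+1) := by
    simp only [Finset.mul_sum]
    rw [← Finset.sum_sub_distrib]
    apply Finset.sum_congr rfl
    intro k hk
    have hk' : k ≤ n := by simpa [Nat.lt_succ_iff] using hk
    rw [← ph_shift, cf_one q a b c hq hq' ha n k hk']
    ring
  rw [this]
  linear_combination ph q a u v 0 * h0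

lemma step_three (q a b c x : ℂ) (hq : q ≠ 0) (hq' : ∀ k : ℕ, q ^ (k+1) ≠ 1) (ha : a ≠ 0)
    (n : ℕ) :
    (1 - c * Complex.exp (Complex.I * x)) * (1 - c * Complex.exp (-(Complex.I * x))) *
      cdqHPoly q a b (q * c) n x
    = (1 - a * c * q ^ n) * (1 - b * c * q ^ n) * cdqHPoly q a b c n x
      - c * cdqHPoly q a b c (n+1) x := by
  simp only [cdq_eq]
  have huv : Complex.exp (Complex.I * x) * Complex.exp (-(Complex.I * x)) = 1 := by
    rw [← Complex.exp_add]; simp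
  generalize Complex.exp (Complex.I * x) = u at *
  generalize Complex.exp (-(Complex.I * x)) = v at *
  rw [sum_ext q a b c u v hq, Finset.sum_range_succ' _ (n+1)]
  have h0 := cf_three_zero q a b c ha n
  have hL : (1 - c * u) * (1 - c * v) * ∑ k ∈ Finset.range (n+1),
      cf q a b (q * c) n k * ph q a u v k
      = ∑ k ∈ Finset.range (n+1), (cf q a b (q * c) n k *
          ((1 - c / (a * q ^ k)) * (1 - a * c * q ^ k))) * ph q a u v k
        + ∑ k ∈ Finset.range (n+1), (cf q a b (q * c) n k *
          (c / (a * q ^ k))) * ph q a u v (k+1) := by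
    rw [Finset.mul_sum, ← Finset.sum_add_distrib]
    apply Finset.sum_congr rfl
    intro k _
    linear_combination cf q a b (q * c) n k * ph_mul q a c u v hq ha huv k
  have hS : ∑ k ∈ Finset.range (n+1), (cf q a b (q * c) n k *
          ((1 - c / (a * q ^ k)) * (1 - a * c * q ^ k))) * ph q a u v k
      = ∑ k ∈ Finset.range (n+1), (cf q a b (q * c) n (k+1) *
          ((1 - c / (a * q ^ (k+1))) * (1 - a * c * q ^ (k+1)))) * ph q a u v (k+1)
        + (cf q a b (q * c) n 0 * ((1 - c / a) * (1 - a * c))) * ph q a u v 0 := by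
    have := Finset.sum_range_succ' (fun k => (cf q a b (q * c) n k *
          ((1 - c / (a * q ^ k)) * (1 - a * c * q ^ k))) * ph q a u v k) (n+1)
    rw [Finset.sum_range_succ _ (n+1), cf_top _ _ _ _ hq] at this
    simpa using this
  have hR : ∑ k ∈ Finset.range (n+1), (cf q a b (q * c) n (k+1) *
          ((1 - c / (a * q ^ (k+1))) * (1 - a * c * q ^ (k+1)))) * ph q a u v (k+1)
        + ∑ k ∈ Finset.range (n+1), (cf q a b (q * c) n k *
          (c / (a * q ^ k))) * ph q a u v (k+1)
      = (1 - a * c * q ^ n) * (1 - b * c * q ^ n) *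
          ∑ k ∈ Finset.range (n+1), cf q a b c n (k+1) * ph q a u v (k+1)
        - c * ∑ k ∈ Finset.range (n+1), cf q a b c (n+1) (k+1) * ph q a u v (k+1) := by
    simp only [Finset.mul_sum]
    rw [← Finset.sum_sub_distrib, ← Finset.sum_add_distrib]
    apply Finset.sum_congr rfl
    intro k hk
    have hk' : k ≤ n := by simpa [Nat.lt_succ_iff] using hk
    linear_combination ph q a u v (k+1) * cf_three q a b c hq hq' ha n k hk'
  rw [hL, hS]
  linear_combination ph q a u v 0 * h0 + hR

lemma cdq_symm (q a b c : ℂ) (n : ℕ) (x : ℂ) : cdqHPoly q a b c n x = cdqHPoly q a c b n x := by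
  unfold cdqHPoly
  congr 1
  apply Finset.sum_congr rfl
  intro k _
  ring

/-- The Christoffel relation (Theorem `thm:PhiPn` of the paper) for the continuous
dual q-Hahn polynomials. -/
theorem continuous_dual_q_hahn_christoffel
    (q : ℝ) (hq0 : 0 < q) (hq1 : q < 1)
    (a₁ a₂ a₃ : ℂ) (h1 : a₁ ≠ 0) (h2 : a₂ ≠ 0) (h3 : a₃ ≠ 0) (n : ℕ) (x : ℂ) :
    ((1 - a₁ * Complex.exp (Complex.I * x)) * (1 - a₁ * Complex.exp (-(Complex.I * x))) *
      ((1 - a₂ * Complex.exp (Complex.I * x)) * (1 - a₂ * Complex.exp (-(Complex.I * x)))) *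
      ((1 - a₃ * Complex.exp (Complex.I * x)) * (1 - a₃ * Complex.exp (-(Complex.I * x))))) *
      cdqHPoly (q : ℂ) ((q : ℂ) * a₁) ((q : ℂ) * a₂) ((q : ℂ) * a₃) n x
    = -(a₁ * a₂ * a₃) * cdqHPoly (q : ℂ) a₁ a₂ a₃ (n + 3) x
      + ((a₁*a₂ + a₁*a₃ + a₂*a₃) - (1 + (q : ℂ)) * (a₁ + a₂ + a₃) * (a₁*a₂*a₃) * (q : ℂ) ^ (n+1)
          + (1 + (q : ℂ) + (q : ℂ) ^ 2) * (a₁*a₂*a₃) ^ 2 * (q : ℂ) ^ (2*n+2)) *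
          cdqHPoly (q : ℂ) a₁ a₂ a₃ (n + 2) x
      - ((a₁ + a₂ + a₃) - (1 + (q : ℂ) + (q : ℂ) ^ 2) * (a₁*a₂*a₃) * (q : ℂ) ^ n) *
          ((1 - a₁*a₂ * (q : ℂ) ^ (n+1)) * (1 - a₁*a₃ * (q : ℂ) ^ (n+1)) *
            (1 - a₂*a₃ * (q : ℂ) ^ (n+1))) *
          cdqHPoly (q : ℂ) a₁ a₂ a₃ (n + 1) x
      + ((1 - a₁*a₂ * (q : ℂ) ^ n) * (1 - a₁*a₂ * (q : ℂ) ^ (n+1)) *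
          (1 - a₁*a₃ * (q : ℂ) ^ n) * (1 - a₁*a₃ * (q : ℂ) ^ (n+1)) *
          (1 - a₂*a₃ * (q : ℂ) ^ n) * (1 - a₂*a₃ * (q : ℂ) ^ (n+1))) *
          cdqHPoly (q : ℂ) a₁ a₂ a₃ n x := by
  have hq : (q : ℂ) ≠ 0 := by exact_mod_cast hq0.ne'
  have hq' : ∀ k : ℕ, (q : ℂ) ^ (k+1) ≠ 1 := by
    intro k h
    have h' : q ^ (k+1) = 1 := by exact_mod_cast h
    exact (pow_lt_one₀ hq0.le hq1 (Nat.succ_ne_zero k)).ne h'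
  generalize (q : ℂ) = p at *
  have s1 := fun m => step_one p a₁ (p * a₂) (p * a₃) x hq hq' h1 m
  have s2 := fun m => step_three p a₁ (p * a₃) a₂ x hq hq' h1 m
  have s3 := fun m => step_three p a₁ a₂ a₃ x hq hq' h1 m
  simp only [cdq_symm p a₁ (p * a₃)] at s2
  have s1n := s1 n
  have s20 := s2 n
  have s21 := s2 (n+1)
  have s30 := s3 n
  have s31 := s3 (n+1)
  have s32 := s3 (n+1+1)
  generalize Complex.exp (Complex.I * x) = u at *
  generalize Complex.exp (-(Complex.I * x)) = v at *
  clear s1 s2 s3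
  rw [show n + 3 = n + 1 + 1 + 1 from rfl, show n + 2 = n + 1 + 1 from rfl]
  rw [show 2 * n + (1 + 1) = n + n + 1 + 1 by ring]
  simp only [pow_succ, pow_add] at *
  generalize p ^ n = N at *
  linear_combination (1 - a₂ * u) * (1 - a₂ * v) * ((1 - a₃ * u) * (1 - a₃ * v)) * s1n
    + (1 - a₃ * u) * (1 - a₃ * v) * ((1 - a₁ * (p * a₂) * N) * (1 - a₁ * (p * a₃) * N) * s20
      - a₁ * s21)
    + (1 - a₁ * (p * a₂) * N) * (1 - a₁ * (p * a₃) * N) *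
       ((1 - a₁ * a₂ * N) * (1 - p * a₃ * a₂ * N) * s30 - a₂ * s31)
    - a₁ * ((1 - a₁ * a₂ * (N * p)) * (1 - p * a₃ * a₂ * (N * p)) * s31 - a₂ * s32)
end

section
/- Let h, μ ∈ ℝ with 2h not an integer, and let n ∈ ℤ≥0. Then for all η ∈ ℂ: (1+η²) · P_n(η; h−1, μ) = P_{n+2}(η; h, μ) − (4μ(2h−n−1)/((2h−2n−1)(2h−2n−3))) · P_{n+1}(η; h, μ) + ((2h−n−1)(2h−n)((2h−2n−1)²+4μ²)/(4(h−n−1)(h−n)(2h−2n−1)²)) · P_n(η; h, μ). -/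
open Complex Finset

/-- Rising Pochhammer symbol `(x)_m = x (x+1) ⋯ (x+m-1)`. -/
noncomputable def poch (x : ℂ) (m : ℕ) : ℂ := ∏ j ∈ Finset.range m, (x + j)

/-- Pseudo Jacobi polynomial `P_n(η; h, μ)` as a function of `η ∈ ℂ`. -/
noncomputable def pseudoJacobiPoly (h μ : ℝ) (n : ℕ) (η : ℂ) : ℂ :=
  (-2 * Complex.I) ^ n * ∑ k ∈ Finset.range (n + 1),
    poch (-(n : ℂ)) k * ((1 - Complex.I * η) / 2) ^ k *
      poch (-(h : ℂ) + 1 / 2 - Complex.I * (μ : ℂ) + k) (n - k) /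
      ((k.factorial : ℂ) * poch ((n : ℂ) - 2 * (h : ℂ) + k) (n - k))

lemma poch_zero' (x : ℂ) : poch x 0 = 1 := by simp [poch]

lemma poch_succ' (x : ℂ) (m : ℕ) : poch x (m + 1) = poch x m * (x + m) := by
  simp [poch, Finset.prod_range_succ]

lemma poch_add' (x : ℂ) (m k : ℕ) : poch x (m + k) = poch x m * poch (x + m) k := by
  simp only [poch, Finset.prod_range_add]
  congr 1
  apply Finset.prod_congr rfl
  intro j _
  push_cast
  ring

lemma poch_shift (x : ℂ) (k : ℕ) : poch x (k + 1) = x * poch (x + 1) k := by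
  rw [add_comm, poch_add', poch_succ', poch_zero']
  simp

lemma poch_ne (x : ℂ) (hx : ∀ m : ℕ, x + m ≠ 0) (k : ℕ) : poch x k ≠ 0 := by
  simp only [poch]
  exact Finset.prod_ne_zero_iff.mpr fun j _ => hx j

lemma poch_neg_zero (n k : ℕ) (hk : n < k) : poch (-(n : ℂ)) k = 0 := by
  simp only [poch]
  exact Finset.prod_eq_zero (Finset.mem_range.mpr hk) (by simp)

/-- Coefficients in closed form. -/
noncomputable def pjC (a b : ℂ) (n k : ℕ) : ℂ :=
  poch (-(n : ℂ)) k * poch a n * poch b (n + k) /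
    ((k.factorial : ℂ) * poch a k * poch b (2 * n))

lemma pjC_zero (a b : ℂ) (n k : ℕ) (hk : n < k) : pjC a b n k = 0 := by
  simp [pjC, poch_neg_zero n k hk]

lemma pjC_eq (a b : ℂ) (ha : ∀ m : ℕ, a + m ≠ 0) (hb : ∀ m : ℕ, b + m ≠ 0) (n k : ℕ)
    (hk : k ≤ n) :
    poch (-(n : ℂ)) k * poch (a + k) (n - k) / ((k.factorial : ℂ) * poch (n + b + k) (n - k))
      = pjC a b n k := by
  obtain ⟨d, rfl⟩ := Nat.exists_eq_add_of_le hk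
  have e1 : k + d - k = d := by omega
  have e2 : 2 * (k + d) = (k + d + k) + d := by ring
  have e3 : ((k + d : ℕ) : ℂ) + b + k = b + ((k + d + k : ℕ) : ℂ) := by push_cast; ring
  rw [e1, e3]
  unfold pjC
  rw [e2, poch_add' a k d, poch_add' b (k + d + k) d]
  have h1 := poch_ne a ha k
  have h2 := poch_ne b hb (k + d + k)
  field_simp

/-- Numerator-free sum, over any range that is long enough. -/
lemma pjP_eq (h μ : ℝ) (n N : ℕ) (η a b : ℂ) (hN : n + 1 ≤ N)
    (ea : a = -(h : ℂ) + 1 / 2 - Complex.I * (μ : ℂ)) (eb : b = -(2 * (h : ℂ)))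
    (ha : ∀ m : ℕ, a + m ≠ 0) (hb : ∀ m : ℕ, b + m ≠ 0) :
    pseudoJacobiPoly h μ n η = (-2 * Complex.I) ^ n *
      ∑ k ∈ Finset.range N, pjC a b n k * ((1 - Complex.I * η) / 2) ^ k := by
  unfold pseudoJacobiPoly
  congr 1
  rw [← Finset.sum_subset (Finset.range_mono hN)]
  · apply Finset.sum_congr rfl
    intro k hk
    rw [← pjC_eq a b ha hb n k (by simp at hk; omega), ea, eb, sub_eq_add_neg (n : ℂ)]
    ring
  · intro k _ hk
    rw [pjC_zero a b n k (by simp at hk; omega), zero_mul]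

noncomputable def pjA (a b : ℂ) (n : ℕ) : ℂ :=
  4 * (b + 1 - 2 * a) * (-b - n - 1) / ((b + 2 * n + 1) * (b + 2 * n + 3))

noncomputable def pjB (a b : ℂ) (n : ℕ) : ℂ :=
  (b + n + 1) * (b + n) * ((b + 2 * n + 1) ^ 2 - (b + 1 - 2 * a) ^ 2) /
    ((b + 2 * n + 2) * (b + 2 * n) * (b + 2 * n + 1) ^ 2)

lemma pjC_succ_k (a b : ℂ) (ha : ∀ m : ℕ, a + m ≠ 0) (n j : ℕ) :
    pjC a b n (j + 1) = pjC a b n j * ((j - n) * (b + n + j) / ((j + 1) * (a + j))) := by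
  have h1 := ha j
  have h2 := poch_ne a ha j
  have h3 : (j : ℂ) + 1 ≠ 0 := by exact_mod_cast j.succ_ne_zero
  unfold pjC
  rw [← add_assoc, poch_succ', poch_succ', poch_succ', Nat.factorial_succ]
  push_cast
  field_simp
  ring

/-- Shift of the degree. -/
lemma pjC_succ_n (a b : ℂ) (ha : ∀ m : ℕ, a + m ≠ 0) (hb : ∀ m : ℕ, b + m ≠ 0) (n j : ℕ) :
    pjC a b (n + 1) (j + 1) = pjC a b n j *
      ((-n - 1) * (a + n) * (b + n + j) * (b + n + j + 1) /
        ((j + 1) * (a + j) * (b + 2 * n) * (b + 2 * n + 1))) := by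
  have h1 := ha j
  have h2 := poch_ne a ha j
  have h3 : (j : ℂ) + 1 ≠ 0 := by exact_mod_cast j.succ_ne_zero
  have h4 := hb (2 * n)
  have h5 := hb (2 * n + 1)
  unfold pjC
  rw [show n + 1 + (j + 1) = n + j + 1 + 1 by ring, show 2 * (n + 1) = 2 * n + 1 + 1 by ring,
    poch_shift (-((n + 1 : ℕ) : ℂ)) j, show -((n + 1 : ℕ) : ℂ) + 1 = -(n : ℂ) by push_cast; ring,
    poch_succ' a n, poch_succ' a j, poch_succ' b, poch_succ' b, poch_succ' b (2 * n + 1),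
    poch_succ' b (2 * n), Nat.factorial_succ]
  push_cast at h4 h5 ⊢
  have h5' : b + 2 * n + 1 ≠ 0 := by rwa [add_assoc]
  simp only [← add_assoc]
  field_simp
  ring

/-- Shift of the parameters. -/
lemma pjC_param (a b : ℂ) (ha : ∀ m : ℕ, a + m ≠ 0) (hb : ∀ m : ℕ, b + m ≠ 0) (n j : ℕ) :
    pjC (a + 1) (b + 2) n j = pjC a b n j *
      ((a + n) * (b + n + j) * (b + n + j + 1) /
        ((a + j) * (b + 2 * n) * (b + 2 * n + 1))) := by
  have hp : ∀ m, poch (a + 1) m = poch a m * (a + m) / a := by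
    intro m
    have := ha 0
    simp only [Nat.cast_zero, add_zero] at this
    rw [← poch_succ', poch_shift]
    field_simp
  have hq : ∀ m : ℕ, poch (b + 2) m = poch b m * (b + m) * (b + m + 1) / (b * (b + 1)) := by
    intro m
    have := hb 0
    have h1 := hb 1
    simp only [Nat.cast_zero, add_zero, Nat.cast_one] at this h1
    have e : poch b m * (b + m) * (b + m + 1) = poch b (m + 1 + 1) := by
      rw [poch_succ', poch_succ']
      push_cast
      ring
    rw [e, poch_shift, poch_shift, show b + 1 + 1 = b + 2 by ring]
    field_simp
  have h0 := ha 0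
  have h0' := hb 0
  have h01 := hb 1
  have h1 := ha j
  have h2 := poch_ne a ha j
  have h4 := hb (2 * n)
  have h5 := hb (2 * n + 1)
  have h6 := poch_ne b hb (2 * n)
  unfold pjC
  simp only [hp, hq]
  push_cast at *
  simp only [add_zero] at h0 h0'
  have h5' : b + 2 * n + 1 ≠ 0 := by rwa [add_assoc]
  simp only [← add_assoc]
  have hf : (j.factorial : ℂ) ≠ 0 := by exact_mod_cast j.factorial_ne_zero
  field_simp

lemma pjC_n_zero (a b : ℂ) (ha : ∀ m : ℕ, a + m ≠ 0) (hb : ∀ m : ℕ, b + m ≠ 0) (n : ℕ) :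
    pjC a b (n + 1) 0 = pjC a b n 0 *
      ((a + n) * (b + n) / ((b + 2 * n) * (b + 2 * n + 1))) := by
  have h4 := hb (2 * n)
  have h5 := hb (2 * n + 1)
  have h6 := poch_ne b hb (2 * n)
  unfold pjC
  rw [show 2 * (n + 1) = 2 * n + 1 + 1 by ring, add_zero, add_zero,
    poch_succ' b, poch_succ' b, poch_succ' b, poch_succ' a]
  simp only [poch_zero']
  push_cast at h4 h5 ⊢
  have h5' : b + 2 * n + 1 ≠ 0 := by rwa [add_assoc]
  simp only [← add_assoc]
  field_simp

lemma pj_rec_zero (a b : ℂ) (ha : ∀ m : ℕ, a + m ≠ 0) (hb : ∀ m : ℕ, b + m ≠ 0) (n : ℕ) :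
    4 * pjC a b (n + 2) 0 = pjA a b n * pjC a b (n + 1) 0 + pjB a b n * pjC a b n 0 := by
  rw [pjC_n_zero a b ha hb (n + 1), pjC_n_zero a b ha hb n]
  have h0 := hb (2 * n)
  have h1 := hb (2 * n + 1)
  have h2 := hb (2 * n + 2)
  have h3 := hb (2 * n + 3)
  unfold pjA pjB
  push_cast at *
  simp only [← add_assoc] at *
  rw [show b + 2 * ((n : ℂ) + 1) = b + 2 * n + 2 by ring,
    show b + 2 * (n : ℂ) + 2 + 1 = b + 2 * n + 3 by ring]
  rw [mul_comm] at h0 h1 h2 h3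
  field_simp
  ring

lemma pj_rec_one (a b : ℂ) (ha : ∀ m : ℕ, a + m ≠ 0) (hb : ∀ m : ℕ, b + m ≠ 0) (n : ℕ) :
    4 * pjC (a + 1) (b + 2) n 0 =
      -4 * pjC a b (n + 2) 1 + pjA a b n * pjC a b (n + 1) 1 + pjB a b n * pjC a b n 1 := by
  have e1 := pjC_succ_n a b ha hb (n + 1) 0
  have e2 := pjC_succ_n a b ha hb n 0
  have e3 := pjC_succ_k a b ha n 0
  have e4 := pjC_param a b ha hb n 0
  rw [zero_add] at e1 e2 e3
  rw [e1, e2, e3, e4, pjC_n_zero a b ha hb n]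
  have h0 := hb (2 * n)
  have h1 := hb (2 * n + 1)
  have h2 := hb (2 * n + 2)
  have h3 := hb (2 * n + 3)
  have h4 := ha 0
  unfold pjA pjB
  push_cast at *
  simp only [← add_assoc] at *
  rw [show b + 2 * ((n : ℂ) + 1) = b + 2 * n + 2 by ring,
    show b + 2 * (n : ℂ) + 2 + 1 = b + 2 * n + 3 by ring]
  simp only [add_zero, zero_add, one_mul] at *
  rw [mul_comm] at h0 h1 h2 h3
  field_simp
  ring

lemma pj_rec_two (a b : ℂ) (ha : ∀ m : ℕ, a + m ≠ 0) (hb : ∀ m : ℕ, b + m ≠ 0) (n j : ℕ) :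
    4 * (pjC (a + 1) (b + 2) n (j + 1) - pjC (a + 1) (b + 2) n j) =
      -4 * pjC a b (n + 2) (j + 2) + pjA a b n * pjC a b (n + 1) (j + 2)
        + pjB a b n * pjC a b n (j + 2) := by
  rw [pjC_param a b ha hb n (j + 1), pjC_param a b ha hb n j,
    pjC_succ_n a b ha hb (n + 1) (j + 1), pjC_succ_n a b ha hb n j,
    pjC_succ_n a b ha hb n (j + 1), pjC_succ_k a b ha n (j + 1), pjC_succ_k a b ha n j]
  have h0 := hb (2 * n)
  have h1 := hb (2 * n + 1)
  have h2 := hb (2 * n + 2)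
  have h3 := hb (2 * n + 3)
  have h4 := ha j
  have h5 := ha (j + 1)
  have h6 : (j : ℂ) + 1 ≠ 0 := by exact_mod_cast j.succ_ne_zero
  have h7 : (j : ℂ) + 2 ≠ 0 := by exact_mod_cast (j + 1).succ_ne_zero
  unfold pjA pjB
  push_cast at *
  simp only [← add_assoc] at *
  rw [show b + 2 * ((n : ℂ) + 1) = b + 2 * n + 2 by ring,
    show b + 2 * (n : ℂ) + 2 + 1 = b + 2 * n + 3 by ring,
    show (j : ℂ) + 1 + 1 = j + 2 by ring]
  rw [mul_comm] at h0 h1 h2 h3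
  field_simp
  ring

lemma pj_main (a b z : ℂ) (ha : ∀ m : ℕ, a + m ≠ 0) (hb : ∀ m : ℕ, b + m ≠ 0) (n : ℕ) :
    4 * (z - z ^ 2) * ∑ k ∈ Finset.range (n + 1), pjC (a + 1) (b + 2) n k * z ^ k =
      -4 * ∑ k ∈ Finset.range (n + 3), pjC a b (n + 2) k * z ^ k
      + pjA a b n * ∑ k ∈ Finset.range (n + 3), pjC a b (n + 1) k * z ^ k
      + pjB a b n * ∑ k ∈ Finset.range (n + 3), pjC a b n k * z ^ k := by
  have hs : ∑ k ∈ Finset.range (n + 1), pjC (a + 1) (b + 2) n k * z ^ k =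
      ∑ k ∈ Finset.range (n + 1), pjC (a + 1) (b + 2) n (k + 1) * z ^ (k + 1)
        + pjC (a + 1) (b + 2) n 0 := by
    have := Finset.sum_range_succ' (fun k => pjC (a + 1) (b + 2) n k * z ^ k) (n + 1)
    rw [Finset.sum_range_succ, pjC_zero _ _ n (n + 1) (by omega)] at this
    simpa using this
  have hl : 4 * (z - z ^ 2) * ∑ k ∈ Finset.range (n + 1), pjC (a + 1) (b + 2) n k * z ^ k =
      (∑ k ∈ Finset.range (n + 1),
        4 * (pjC (a + 1) (b + 2) n (k + 1) - pjC (a + 1) (b + 2) n k) * z ^ (k + 2))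
        + 4 * pjC (a + 1) (b + 2) n 0 * z := by
    have e : ∑ k ∈ Finset.range (n + 1),
        4 * (pjC (a + 1) (b + 2) n (k + 1) - pjC (a + 1) (b + 2) n k) * z ^ (k + 2)
        = 4 * z * (∑ k ∈ Finset.range (n + 1), pjC (a + 1) (b + 2) n (k + 1) * z ^ (k + 1))
          - 4 * z ^ 2 * ∑ k ∈ Finset.range (n + 1), pjC (a + 1) (b + 2) n k * z ^ k := by
      rw [Finset.mul_sum, Finset.mul_sum, ← Finset.sum_sub_distrib]
      exact Finset.sum_congr rfl fun k _ => by ring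
    rw [e]
    linear_combination 4 * z * hs
  rw [hl]
  simp only [Finset.mul_sum, ← Finset.sum_add_distrib]
  rw [Finset.sum_range_succ' _ (n + 2), Finset.sum_range_succ' _ (n + 1)]
  simp only [pow_zero, zero_add, pow_one]
  have e0 := pj_rec_zero a b ha hb n
  have e1 := pj_rec_one a b ha hb n
  simp only [pj_rec_two a b ha hb n]
  have e2 : ∀ f g : ℕ → ℂ, (∀ k, f k = g k) →
      ∑ k ∈ Finset.range (n + 1), f k = ∑ k ∈ Finset.range (n + 1), g k :=
    fun f g H => Finset.sum_congr rfl fun k _ => H k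
  rw [e1, add_assoc (Finset.sum _ _)]
  refine congrArg₂ (· + ·) (e2 _ _ fun k => by ring) ?_
  linear_combination e0

/-- The Christoffel relation (Theorem `thm:PhiPnoQM` of the paper) for the pseudo
Jacobi polynomials. -/
theorem pseudo_jacobi_christoffel
    (h μ : ℝ) (hh : ∀ m : ℤ, 2 * h ≠ (m : ℝ)) (n : ℕ) (η : ℂ) :
    (1 + η ^ 2) * pseudoJacobiPoly (h - 1) μ n η
    = pseudoJacobiPoly h μ (n + 2) η
      - 4 * (μ : ℂ) * (2 * (h : ℂ) - n - 1) /
          ((2 * (h : ℂ) - 2 * n - 1) * (2 * (h : ℂ) - 2 * n - 3)) *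
          pseudoJacobiPoly h μ (n + 1) η
      + (2 * (h : ℂ) - n - 1) * (2 * (h : ℂ) - n) *
          ((2 * (h : ℂ) - 2 * n - 1) ^ 2 + 4 * (μ : ℂ) ^ 2) /
          (4 * ((h : ℂ) - n - 1) * ((h : ℂ) - n) * (2 * (h : ℂ) - 2 * n - 1) ^ 2) *
          pseudoJacobiPoly h μ n η := by
  have hI := Complex.I_sq
  set a : ℂ := -(h : ℂ) + 1 / 2 - Complex.I * (μ : ℂ) with ea
  set b : ℂ := -(2 * (h : ℂ)) with eb
  have key : ∀ m : ℤ, -(2 * (h : ℂ)) + m ≠ 0 := by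
    intro m H
    apply hh m
    have : (((2 * h : ℝ)) : ℂ) = ((m : ℝ) : ℂ) := by
      push_cast
      linear_combination -H
    exact_mod_cast this
  have hb : ∀ m : ℕ, b + m ≠ 0 := fun m => by simpa using key m
  have ha : ∀ m : ℕ, a + m ≠ 0 := by
    intro m H
    have hre := congrArg Complex.re H
    rw [ea] at hre
    simp at hre
    apply hh (2 * m + 1)
    push_cast
    linarith
  have ha' : ∀ m : ℕ, a + 1 + m ≠ 0 := fun m => by
    have := ha (m + 1)
    push_cast at this
    rwa [add_assoc, add_comm (1 : ℂ)]
  have hb' : ∀ m : ℕ, b + 2 + m ≠ 0 := fun m => by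
    have := hb (m + 2)
    push_cast at this
    rwa [add_assoc, add_comm (2 : ℂ)]
  rw [pjP_eq (h - 1) μ n (n + 1) η (a + 1) (b + 2) le_rfl (by rw [ea]; push_cast; ring)
      (by rw [eb]; push_cast; ring) ha' hb',
    pjP_eq h μ (n + 2) (n + 3) η a b le_rfl ea eb ha hb,
    pjP_eq h μ (n + 1) (n + 3) η a b (by omega) ea eb ha hb,
    pjP_eq h μ n (n + 3) η a b (by omega) ea eb ha hb]
  have M := pj_main a b ((1 - Complex.I * η) / 2) ha hb n
  have hz : 4 * ((1 - Complex.I * η) / 2 - ((1 - Complex.I * η) / 2) ^ 2) = 1 + η ^ 2 := by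
    linear_combination -η ^ 2 * hI
  rw [hz] at M
  have hA : 4 * (μ : ℂ) * (2 * (h : ℂ) - n - 1) /
      ((2 * (h : ℂ) - 2 * n - 1) * (2 * (h : ℂ) - 2 * n - 3)) * (2 * Complex.I) = pjA a b n := by
    unfold pjA
    rw [show (b + 2 * n + 1) * (b + 2 * n + 3) =
      (2 * (h : ℂ) - 2 * n - 1) * (2 * (h : ℂ) - 2 * n - 3) by rw [eb]; ring, ea, eb]
    ring
  have hB : (2 * (h : ℂ) - n - 1) * (2 * (h : ℂ) - n) *
          ((2 * (h : ℂ) - 2 * n - 1) ^ 2 + 4 * (μ : ℂ) ^ 2) /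
          (4 * ((h : ℂ) - n - 1) * ((h : ℂ) - n) * (2 * (h : ℂ) - 2 * n - 1) ^ 2)
      = pjB a b n := by
    unfold pjB
    rw [show (b + 2 * n + 2) * (b + 2 * n) * (b + 2 * n + 1) ^ 2 =
      4 * ((h : ℂ) - n - 1) * ((h : ℂ) - n) * (2 * (h : ℂ) - 2 * n - 1) ^ 2 by rw [eb]; ring]
    congr 1
    rw [ea, eb]
    linear_combination (2 * (h : ℂ) - n - 1) * (2 * (h : ℂ) - n) * 4 * (μ : ℂ) ^ 2 * hI
  rw [hB]
  rw [← hA] at M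
  rw [pow_add, pow_add]
  linear_combination (-2 * Complex.I) ^ n * M - 4 * (-2 * Complex.I) ^ n *
    (∑ k ∈ Finset.range (n + 3), pjC a b (n + 2) k * ((1 - Complex.I * η) / 2) ^ k) * hI
end
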